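/- For every y ∈ ℝ and every t ≥ 0, U^{(y)}(t) = y + f(t) − L^{(y)}(t) + R^{(y)}(t). Moreover, L^{(y)} and R^{(y)} are non-decreasing on [0,∞) with L^{(y)}(0) = 0, U^{(y)}(t) ≥ 0 for all t ≥ 0, L^{(y)} is constant on each interval [T_k, T_{k+1}) (it increases only at the times T_k, k ≥ 1), and U^{(y)}(T_k) ≤ a for every k ≥ 1. -/

import Mathlib

open Filter Set

/-- A càdlàg function: right-continuous with left limits. -/
def CadlagFun (f : ℝ → ℝ) : Prop :=
  (∀ t : ℝ, ContinuousWithinAt f (Set.Ici t) t) ∧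
  (∀ t : ℝ, ∃ l : ℝ, Tendsto f (nhdsWithin t (Set.Iio t)) (nhds l))

/-- A strictly increasing sequence of times starting at `0` and tending to `∞`. -/
def IsTimeGrid (T : ℕ → ℝ) : Prop :=
  T 0 = 0 ∧ StrictMono T ∧ Tendsto T atTop atTop

/-- The periodic-classical reflected triple `(U, L, R)` of the path `t ↦ y + f t`:
classical reflection below at level `0`, periodic reflection above at level `a` at the
times `T k`, defined by the recursive specification. -/
structure IsPCTriple (a : ℝ) (T : ℕ → ℝ) (f : ℝ → ℝ) (y : ℝ)
    (U L R : ℝ → ℝ) : Prop where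
  L_first : ∀ t : ℝ, 0 ≤ t → t < T 1 → L t = 0
  R_first : ∀ t : ℝ, 0 ≤ t → t < T 1 →
    R t = max 0 (-sInf ((fun s => y + f s) '' Set.Icc 0 t))
  U_first : ∀ t : ℝ, 0 ≤ t → t < T 1 → U t = y + f t + R t
  R_seg : ∀ (k : ℕ) (t : ℝ), T k < t → t < T (k + 1) →
    R t = R (T k) + max 0 (-sInf ((fun s => U (T k) + f s - f (T k)) '' Set.Icc (T k) t))
  U_seg : ∀ (k : ℕ) (t : ℝ), T k < t → t < T (k + 1) →
    U t = (U (T k) + f t - f (T k)) + (R t - R (T k))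
  L_seg : ∀ (k : ℕ) (t : ℝ), T k < t → t < T (k + 1) → L t = L (T k)
  R_jump : ∀ k : ℕ, R (T (k + 1)) = R (T k) +
    max 0 (-sInf ((fun s => U (T k) + f s - f (T k)) '' Set.Icc (T k) (T (k + 1))))
  L_jump : ∀ k : ℕ, L (T (k + 1)) = L (T k) +
    max (((U (T k) + f (T (k + 1)) - f (T k)) + (R (T (k + 1)) - R (T k))) - a) 0
  U_jump : ∀ k : ℕ, U (T (k + 1)) =
    min ((U (T k) + f (T (k + 1)) - f (T k)) + (R (T (k + 1)) - R (T k))) a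

/-- `τ_0^{(y),-} = inf {t ≥ 0 : y + f t < 0}`, with `inf ∅ = +∞`, as an extended real. -/
noncomputable def tauMinus (f : ℝ → ℝ) (y : ℝ) : EReal :=
  sInf ((fun t : ℝ => (t : EReal)) '' {t : ℝ | 0 ≤ t ∧ y + f t < 0})

/-- `T_a^{(y),+} = inf {T k : k ≥ 1, y + f (T k) > a}`, with `inf ∅ = +∞`. -/
noncomputable def TPlus (a : ℝ) (T : ℕ → ℝ) (f : ℝ → ℝ) (y : ℝ) : EReal :=
  sInf ((fun t : ℝ => (t : EReal)) ''
    {t : ℝ | ∃ k : ℕ, 1 ≤ k ∧ t = T k ∧ a < y + f (T k)})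

/-- A càdlàg function is bounded below near every point. -/
lemma CadlagFun.exists_eventually_ge {f : ℝ → ℝ} (hf : CadlagFun f) (t : ℝ) :
    ∃ c : ℝ, ∀ᶠ s in nhds t, c ≤ f s := by
  obtain ⟨l, hl⟩ := hf.2 t
  refine ⟨min (l - 1) (f t - 1), ?_⟩
  have hleft : ∀ᶠ s in nhdsWithin t (Iio t), l - 1 < f s :=
    hl.eventually (lt_mem_nhds (sub_one_lt l))
  have hright : ∀ᶠ s in nhdsWithin t (Ici t), f t - 1 < f s :=
    (hf.1 t).eventually (lt_mem_nhds (sub_one_lt (f t)))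
  have hsup := hleft.mono fun s hs => (min_le_left (l - 1) (f t - 1)).trans hs.le
  have hsup' := hright.mono fun s hs => (min_le_right (l - 1) (f t - 1)).trans hs.le
  have := eventually_sup.2 ⟨hsup, hsup'⟩
  rwa [← nhdsWithin_union, Iio_union_Ici, nhdsWithin_univ] at this

/-- A càdlàg function is bounded below on compact sets. -/
lemma CadlagFun.bddBelow_image {f : ℝ → ℝ} (hf : CadlagFun f) {K : Set ℝ} (hK : IsCompact K) :
    BddBelow (f '' K) := by
  refine hK.induction_on (p := fun s => BddBelow (f '' s)) (by simp)
    (fun s t hst ht => ht.mono (image_mono hst))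
    (fun s t hs ht => by rw [image_union]; exact hs.union ht) fun t _ => ?_
  obtain ⟨c, hc⟩ := hf.exists_eventually_ge t
  exact ⟨_, mem_nhdsWithin_of_mem_nhds hc, c, by rintro _ ⟨s, hs, rfl⟩; exact hs⟩

lemma CadlagFun.bddBelow_image_add_sub {f : ℝ → ℝ} (hf : CadlagFun f) (u v p q : ℝ) :
    BddBelow ((fun s => u + f s - v) '' Icc p q) := by
  obtain ⟨c, hc⟩ := hf.bddBelow_image (isCompact_Icc (a := p) (b := q))
  refine ⟨u + c - v, ?_⟩
  rintro _ ⟨s, hs, rfl⟩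
  have := hc (mem_image_of_mem f hs)
  dsimp only
  linarith

lemma IsTimeGrid.nonneg {T : ℕ → ℝ} (hT : IsTimeGrid T) (k : ℕ) : 0 ≤ T k :=
  hT.1 ▸ hT.2.1.monotone k.zero_le

/-- The half-open cells of a time grid cover the half-line. -/
lemma IsTimeGrid.exists_mem_Ico {T : ℕ → ℝ} (hT : IsTimeGrid T) {t : ℝ} (ht : 0 ≤ t) :
    ∃ k, T k ≤ t ∧ t < T (k + 1) := by
  by_contra! h
  have hle : ∀ k, T k ≤ t := fun k => by
    induction k with
    | zero => exact hT.1.trans_le ht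
    | succ k ih => exact h k ih
  obtain ⟨k, hk⟩ := (hT.2.2.eventually_gt_atTop t).exists
  exact (hle k).not_gt hk

/-- A function that is monotone on each cell of a time grid is monotone on the half-line. -/
lemma IsTimeGrid.monotoneOn_Ici {T : ℕ → ℝ} (hT : IsTimeGrid T) {g : ℝ → ℝ}
    (hg : ∀ k, MonotoneOn g (Icc (T k) (T (k + 1)))) : MonotoneOn g (Ici 0) := by
  have hn : ∀ n, MonotoneOn g (Icc 0 (T n)) := fun n => by
    induction n with
    | zero => simp [hT.1]
    | succ n ih =>
      have hle : T n ≤ T (n + 1) := hT.2.1.monotone n.le_succ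
      rw [← Icc_union_Icc_eq_Icc (hT.nonneg n) hle]
      exact ih.union_right (hg n) (isGreatest_Icc (hT.nonneg n)) (isLeast_Icc hle)
  intro s hs t ht hst
  obtain ⟨n, -, hlt⟩ := hT.exists_mem_Ico ht
  exact hn (n + 1) ⟨hs, hst.trans hlt.le⟩ ⟨ht, hlt.le⟩ hst

namespace IsPCTriple

variable {a : ℝ} {T : ℕ → ℝ} {f : ℝ → ℝ} {y : ℝ} {U L R : ℝ → ℝ}

lemma L_zero (h : IsPCTriple a T f y U L R) (hT : IsTimeGrid T) : L 0 = 0 :=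
  h.L_first 0 le_rfl (hT.1 ▸ hT.2.1 zero_lt_one)

lemma U_zero (h : IsPCTriple a T f y U L R) (hT : IsTimeGrid T) : U 0 = y + f 0 + R 0 :=
  h.U_first 0 le_rfl (hT.1 ▸ hT.2.1 zero_lt_one)

lemma R_zero (h : IsPCTriple a T f y U L R) (hT : IsTimeGrid T) :
    R 0 = max 0 (-(y + f 0)) := by
  simpa using h.R_first 0 le_rfl (hT.1 ▸ hT.2.1 zero_lt_one)

lemma L_eq_of_mem_Ico (h : IsPCTriple a T f y U L R) {k : ℕ} {t : ℝ}
    (h₁ : T k ≤ t) (h₂ : t < T (k + 1)) : L t = L (T k) := by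
  rcases h₁.eq_or_lt with rfl | h₁
  · rfl
  · exact h.L_seg k t h₁ h₂

/-- The compensator `R` makes the path on a cell, before truncation at `a`, nonnegative. -/
lemma reflected_nonneg (hf : CadlagFun f) {k : ℕ} {t : ℝ} (hkt : T k ≤ t)
    (hR : R t = R (T k) +
      max 0 (-sInf ((fun s => U (T k) + f s - f (T k)) '' Icc (T k) t))) :
    0 ≤ (U (T k) + f t - f (T k)) + (R t - R (T k)) := by
  have hinf := csInf_le (hf.bddBelow_image_add_sub (U (T k)) (f (T k)) (T k) t)
    (mem_image_of_mem (fun s => U (T k) + f s - f (T k)) (right_mem_Icc.2 hkt))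
  have hmax := le_max_right 0 (-sInf ((fun s => U (T k) + f s - f (T k)) '' Icc (T k) t))
  linarith

lemma U_grid_nonneg (h : IsPCTriple a T f y U L R) (ha : 0 ≤ a) (hT : IsTimeGrid T)
    (hf : CadlagFun f) (k : ℕ) : 0 ≤ U (T k) := by
  cases k with
  | zero =>
    rw [hT.1, h.U_zero hT, h.R_zero hT]
    linarith [le_max_right 0 (-(y + f 0))]
  | succ k =>
    rw [h.U_jump k]
    exact le_min (reflected_nonneg hf (hT.2.1.monotone k.le_succ) (h.R_jump k)) ha

lemma U_nonneg (h : IsPCTriple a T f y U L R) (ha : 0 ≤ a) (hT : IsTimeGrid T)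
    (hf : CadlagFun f) {t : ℝ} (ht : 0 ≤ t) : 0 ≤ U t := by
  obtain ⟨k, h₁, h₂⟩ := hT.exists_mem_Ico ht
  rcases h₁.eq_or_lt with rfl | h₁
  · exact h.U_grid_nonneg ha hT hf k
  · rw [h.U_seg k t h₁ h₂]
    exact reflected_nonneg hf h₁.le (h.R_seg k t h₁ h₂)

/-- The formula for `R` holds on closed cells. -/
lemma R_eq_of_mem_Icc (h : IsPCTriple a T f y U L R) (ha : 0 ≤ a) (hT : IsTimeGrid T)
    (hf : CadlagFun f) {k : ℕ} {t : ℝ} (ht : t ∈ Icc (T k) (T (k + 1))) :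
    R t = R (T k) + max 0 (-sInf ((fun s => U (T k) + f s - f (T k)) '' Icc (T k) t)) := by
  rcases ht.1.eq_or_lt with rfl | h₁
  · simp [h.U_grid_nonneg ha hT hf k]
  rcases ht.2.eq_or_lt with rfl | h₂
  · exact h.R_jump k
  · exact h.R_seg k t h₁ h₂

lemma R_monotoneOn (h : IsPCTriple a T f y U L R) (ha : 0 ≤ a) (hT : IsTimeGrid T)
    (hf : CadlagFun f) : MonotoneOn R (Ici 0) := by
  refine hT.monotoneOn_Ici fun k s hs t ht hst => ?_
  rw [h.R_eq_of_mem_Icc ha hT hf hs, h.R_eq_of_mem_Icc ha hT hf ht]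
  have := csInf_le_csInf (hf.bddBelow_image_add_sub (U (T k)) (f (T k)) (T k) t)
    ((nonempty_Icc.2 hs.1).image (fun s => U (T k) + f s - f (T k)))
    (image_mono (Icc_subset_Icc_right hst))
  gcongr

lemma L_monotoneOn (h : IsPCTriple a T f y U L R) (hT : IsTimeGrid T) :
    MonotoneOn L (Ici 0) := by
  refine hT.monotoneOn_Ici fun k s hs t ht hst => ?_
  have hjump : L (T k) ≤ L (T (k + 1)) := by
    rw [h.L_jump k]
    exact le_add_of_nonneg_right (le_max_right _ _)
  rcases hst.eq_or_lt with rfl | hst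
  · rfl
  rw [h.L_eq_of_mem_Ico hs.1 (hst.trans_le ht.2)]
  rcases ht.2.eq_or_lt with rfl | h₂
  · exact hjump
  · exact (h.L_eq_of_mem_Ico ht.1 h₂).ge

lemma U_grid_eq (h : IsPCTriple a T f y U L R) (hT : IsTimeGrid T) (k : ℕ) :
    U (T k) = y + f (T k) - L (T k) + R (T k) := by
  induction k with
  | zero => rw [hT.1, h.U_zero hT, h.L_zero hT, sub_zero]
  | succ k ih =>
    rw [h.U_jump k, h.L_jump k]
    rcases le_total ((U (T k) + f (T (k + 1)) - f (T k)) + (R (T (k + 1)) - R (T k))) a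
      with hle | hle
    · rw [min_eq_left hle, max_eq_right (sub_nonpos.2 hle)]
      linarith
    · rw [min_eq_right hle, max_eq_left (sub_nonneg.2 hle)]
      linarith

lemma U_eq (h : IsPCTriple a T f y U L R) (hT : IsTimeGrid T) {t : ℝ} (ht : 0 ≤ t) :
    U t = y + f t - L t + R t := by
  obtain ⟨k, h₁, h₂⟩ := hT.exists_mem_Ico ht
  rcases h₁.eq_or_lt with rfl | h₁
  · exact h.U_grid_eq hT k
  · linarith [h.U_seg k t h₁ h₂, h.L_seg k t h₁ h₂, h.U_grid_eq hT k]

lemma U_grid_le (h : IsPCTriple a T f y U L R) {k : ℕ} (hk : 1 ≤ k) : U (T k) ≤ a := by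
  obtain ⟨k, rfl⟩ := Nat.exists_eq_add_of_le' hk
  exact (h.U_jump k).trans_le (min_le_right _ _)

end IsPCTriple

/-- Basic properties of the periodic-classical reflected triple: the decomposition
`U⁽ʸ⁾ t = y + f t - L⁽ʸ⁾ t + R⁽ʸ⁾ t`, monotonicity of `L⁽ʸ⁾` and `R⁽ʸ⁾`, `L⁽ʸ⁾ 0 = 0`,
non-negativity of `U⁽ʸ⁾`, `L⁽ʸ⁾` constant on each `[T k, T (k+1))`, and `U⁽ʸ⁾ (T k) ≤ a`
for `k ≥ 1`. -/
theorem stmt9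
    (a : ℝ) (ha : 0 ≤ a) (T : ℕ → ℝ) (hT : IsTimeGrid T)
    (f : ℝ → ℝ) (hf : CadlagFun f) (hf0 : f 0 = 0)
    (hfT : ∀ k : ℕ, 1 ≤ k → ContinuousAt f (T k))
    (y : ℝ) (U L R : ℝ → ℝ)
    (htriple : IsPCTriple a T f y U L R) :
    (∀ t : ℝ, 0 ≤ t → U t = y + f t - L t + R t) ∧
    MonotoneOn L (Set.Ici 0) ∧ MonotoneOn R (Set.Ici 0) ∧ L 0 = 0 ∧
    (∀ t : ℝ, 0 ≤ t → 0 ≤ U t) ∧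
    (∀ k : ℕ, ∀ t : ℝ, T k ≤ t → t < T (k + 1) → L t = L (T k)) ∧
    (∀ k : ℕ, 1 ≤ k → U (T k) ≤ a) := by
  exact ⟨fun _ ht => htriple.U_eq hT ht, htriple.L_monotoneOn hT, htriple.R_monotoneOn ha hT hf,
    htriple.L_zero hT, fun _ ht => htriple.U_nonneg ha hT hf ht,
    fun _ _ h₁ h₂ => htriple.L_eq_of_mem_Ico h₁ h₂, fun _ hk => htriple.U_grid_le hk⟩
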